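/- Fix real numbers a ≤ b < 0 and h₀>0. Then there exists C>0 such that for every h∈(0,h₀] and every real z∈[a,b], the matrix Q(z,h) on ℤ²×ℤ² with diagonal entries Q(m,m) := q(z,h) and off-diagonal entries Q(m,n) := exp(−ih(m₁−n₁)(m₂+n₂)/2)·F_h(|m−n|,z) (m≠n) defines a bounded operator on ℓ²(ℤ²;ℂ) of operator norm at most C. (Consequently, for |α| < 1/C the operator Q(z,h)+α^{−1} is invertible for all z∈[a,b], so the perturbed Landau Hamiltonian H_{h,α} has no spectrum in [a,b].) -/

import Mathlib

open MeasureTheory Real Set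

/-- Modulus of the Landau heat kernel at distance `r`. -/
noncomputable def landauHeatKernel (h r t : ℝ) : ℝ :=
  h / (4 * π * Real.sinh (h * t)) *
    Real.exp (-(h * r ^ 2 * (Real.cosh (h * t) / Real.sinh (h * t))) / 4)

/-- `F_h(r,z) = ∫₀^∞ e^{zt} p_h(r,t) dt`, in modulus the Green function of the Landau
Hamiltonian at distance `r`. -/
noncomputable def landauGreen (h r : ℝ) (z : ℂ) : ℂ :=
  ∫ t in Ioi (0 : ℝ), Complex.exp (z * t) * ((landauHeatKernel h r t : ℝ) : ℂ)

/-- Regularized diagonal value of the free Green function: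
`q_0(z) = −(Log(−z) − log 4 + 2γ)/(4π)`. -/
noncomputable def q0 (z : ℂ) : ℂ :=
  -(Complex.log (-z) - Real.log 4 + 2 * Real.eulerMascheroniConstant) / (4 * π)

/-- Regularized diagonal value of the Green function of the Landau Hamiltonian. -/
noncomputable def qDiag (h : ℝ) (z : ℂ) : ℂ :=
  q0 z + ∫ t in Ioi (0 : ℝ),
    Complex.exp (z * t) * (((1 / (4 * π)) * (h / Real.sinh (h * t) - 1 / t) : ℝ) : ℂ)

/-- The lattice Green-function matrix `Q(z,h)` of the Landau Hamiltonian restricted to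
`ℤ²`, with regularized diagonal. -/
noncomputable def Qmat (h : ℝ) (z : ℂ) (m n : ℤ × ℤ) : ℂ :=
  if m = n then qDiag h z
  else Complex.exp (-Complex.I * h * ((m.1 : ℂ) - n.1) * ((m.2 : ℂ) + n.2) / 2) *
    landauGreen h (Real.sqrt (((m.1 : ℝ) - n.1) ^ 2 + ((m.2 : ℝ) - n.2) ^ 2)) z

/-- `ℓ²(ℤ²;ℂ)`. -/
noncomputable abbrev l2Z2 : Type := lp (fun _ : ℤ × ℤ => ℂ) 2

/-- The composition of a translation of `ℓ²(G)` with multiplication by a bounded function. -/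
theorem exists_weighted_translation {G : Type*} [AddCommGroup G] (φ : G → ℂ) (k : G) (c : ℝ)
    (hφ : ∀ m, ‖φ m‖ ≤ c) :
    ∃ A : lp (fun _ : G => ℂ) 2 →L[ℂ] lp (fun _ : G => ℂ) 2,
      ‖A‖ ≤ c ∧ ∀ (f : lp (fun _ : G => ℂ) 2) (m : G), A f m = φ m * f (m - k) := by
  have hc : 0 ≤ c := (norm_nonneg _).trans (hφ 0)
  have h2 : (0 : ℝ) < (2 : ENNReal).toReal := by norm_num
  have hsum (f : lp (fun _ : G => ℂ) 2) (s : Finset G) :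
      ∑ m ∈ s, ‖φ m * f (m - k)‖ ^ (2 : ENNReal).toReal ≤ (c * ‖f‖) ^ (2 : ENNReal).toReal := by
    calc ∑ m ∈ s, ‖φ m * f (m - k)‖ ^ (2 : ENNReal).toReal
        ≤ ∑ m ∈ s, c ^ (2 : ENNReal).toReal * ‖f (m - k)‖ ^ (2 : ENNReal).toReal := by
          gcongr with m
          rw [norm_mul, Real.mul_rpow (norm_nonneg _) (norm_nonneg _)]
          gcongr
          exact hφ m
      _ = c ^ (2 : ENNReal).toReal *
            ∑ n ∈ s.map (Equiv.subRight k).toEmbedding, ‖f n‖ ^ (2 : ENNReal).toReal := by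
          rw [← Finset.mul_sum, Finset.sum_map]
          rfl
      _ ≤ (c * ‖f‖) ^ (2 : ENNReal).toReal := by
          rw [Real.mul_rpow hc (norm_nonneg _)]
          gcongr
          exact lp.sum_rpow_le_norm_rpow h2 f _
  let L : lp (fun _ : G => ℂ) 2 →ₗ[ℂ] lp (fun _ : G => ℂ) 2 :=
    { toFun := fun f => ⟨fun m => φ m * f (m - k), memℓp_gen' (hsum f)⟩
      map_add' := fun f g => by
        ext m
        exact mul_add _ _ _
      map_smul' := fun a f => by
        ext m
        exact mul_left_comm _ _ _ }
  exact ⟨L.mkContinuous c fun f =>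
      lp.norm_le_of_forall_sum_le h2 (by positivity) (hsum f),
    L.mkContinuous_norm_le hc _, fun _ _ => rfl⟩

/-- A matrix dominated by a summable convolution kernel acts boundedly on `ℓ²(G)`. -/
theorem exists_clm_of_convolution_bound {G : Type*} [AddCommGroup G] (Q : G → G → ℂ)
    (w : G → ℝ) (hw : Summable w) (hQ : ∀ m n, ‖Q m n‖ ≤ w (m - n)) :
    ∃ T : lp (fun _ : G => ℂ) 2 →L[ℂ] lp (fun _ : G => ℂ) 2,
      ‖T‖ ≤ ∑' k, w k ∧
        ∀ (f : lp (fun _ : G => ℂ) 2) (m : G), T f m = ∑' n, Q m n * f n := by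
  choose A hA hAf using fun k : G =>
    exists_weighted_translation (fun m => Q m (m - k)) k (w k)
      fun m => by simpa using hQ m (m - k)
  have hAs : Summable A := hw.of_norm_bounded hA
  refine ⟨∑' k, A k, tsum_of_norm_bounded hw.hasSum hA, fun f m => ?_⟩
  have hev := (lp.evalCLM ℂ (fun _ : G => ℂ) 2 m).hasSum
    ((ContinuousLinearMap.apply ℂ _ f).hasSum hAs.hasSum)
  rw [← (Equiv.subLeft m).tsum_eq (fun n => Q m n * f n)]
  refine hev.tsum_eq.symm.trans (tsum_congr fun k => ?_)
  exact hAf k f m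

theorem sinh_le_mul_cosh {x : ℝ} (hx : 0 ≤ x) : Real.sinh x ≤ x * Real.cosh x := by
  have hd (y : ℝ) : HasDerivAt (fun y => y * Real.cosh y - Real.sinh y) (y * Real.sinh y) y := by
    have := ((hasDerivAt_id y).mul (Real.hasDerivAt_cosh y)).sub (Real.hasDerivAt_sinh y)
    exact this.congr_deriv (by simp)
  have hmono : MonotoneOn (fun y => y * Real.cosh y - Real.sinh y) (Ici 0) := by
    refine monotoneOn_of_deriv_nonneg (convex_Ici 0)
      (fun y _ => (hd y).continuousAt.continuousWithinAt)
      (fun y _ => (hd y).differentiableAt.differentiableWithinAt) fun y hy => ?_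
    rw [interior_Ici] at hy
    rw [(hd y).deriv]
    exact mul_nonneg (le_of_lt hy) (Real.sinh_nonneg_iff.2 (le_of_lt hy))
  have := hmono (mem_Ici.2 le_rfl) (mem_Ici.2 hx) hx
  simp only [Real.sinh_zero, zero_mul, sub_zero] at this
  linarith

/-- The Landau heat kernel is dominated by the free one. -/
theorem landauHeatKernel_le {h t : ℝ} (r : ℝ) (hh : 0 < h) (ht : 0 < t) :
    landauHeatKernel h r t ≤ 1 / (4 * π * t) * Real.exp (-(r ^ 2 / (4 * t))) := by
  have hx : 0 < h * t := mul_pos hh ht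
  have hs : 0 < Real.sinh (h * t) := Real.sinh_pos_iff.2 hx
  have h1 : h * t ≤ Real.sinh (h * t) := Real.self_le_sinh_iff.2 hx.le
  have h2 := sinh_le_mul_cosh hx.le
  unfold landauHeatKernel
  have hpi := Real.pi_pos
  gcongr ?_ * Real.exp ?_
  · rw [div_le_div_iff₀ (by positivity) (by positivity)]
    nlinarith [mul_le_mul_of_nonneg_left h1 hpi.le]
  · have h3 : 1 / t ≤ h * (Real.cosh (h * t) / Real.sinh (h * t)) := by
      rw [mul_div_assoc', div_le_div_iff₀ ht hs]
      linarith
    have := mul_le_mul_of_nonneg_left h3 (by positivity : 0 ≤ r ^ 2 / 4)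
    have e : r ^ 2 / (4 * t) = r ^ 2 / 4 * (1 / t) := by field_simp
    rw [e]
    linarith

theorem landauHeatKernel_nonneg {h t : ℝ} (r : ℝ) (hh : 0 < h) (ht : 0 < t) :
    0 ≤ landauHeatKernel h r t := by
  have hs : 0 < Real.sinh (h * t) := Real.sinh_pos_iff.2 (mul_pos hh ht)
  unfold landauHeatKernel
  positivity

theorem norm_exp_ofReal_mul (z t : ℝ) : ‖Complex.exp ((z : ℂ) * t)‖ = Real.exp (z * t) := by
  rw [Complex.norm_exp]
  simp

theorem landauHeatKernel_le_div {h t r : ℝ} (hh : 0 < h) (ht : 0 < t) (hr : 0 < r) :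
    landauHeatKernel h r t ≤ 8 * t / (π * r ^ 4) := by
  refine (landauHeatKernel_le r hh ht).trans ?_
  have hq := Real.quadratic_le_exp_of_nonneg (by positivity : 0 ≤ r ^ 2 / (4 * t))
  have hx : 0 < r ^ 2 / (4 * t) := by positivity
  have hexp : Real.exp (-(r ^ 2 / (4 * t))) ≤ 1 / ((r ^ 2 / (4 * t)) ^ 2 / 2) := by
    rw [Real.exp_neg, ← one_div]
    exact one_div_le_one_div_of_le (by positivity) (by linarith)
  calc 1 / (4 * π * t) * Real.exp (-(r ^ 2 / (4 * t)))
      ≤ 1 / (4 * π * t) * (1 / ((r ^ 2 / (4 * t)) ^ 2 / 2)) := by gcongr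
    _ = 8 * t / (π * r ^ 4) := by
      field_simp
      norm_num

/-- The Green function decays like `r⁻⁴`, uniformly in the field. -/
theorem norm_landauGreen_le {b h r z : ℝ} (hb : b < 0) (hh : 0 < h) (hr : 0 < r) (hz : z ≤ b) :
    ‖landauGreen h r z‖ ≤ 32 / (π * b ^ 2) / r ^ 4 := by
  have hint := integrableOn_exp_mul_Ioi (by linarith : b / 2 < 0) 0
  have key : ‖landauGreen h r z‖ ≤
      ∫ t in Ioi (0 : ℝ), 16 / (π * r ^ 4 * (-b)) * Real.exp (b / 2 * t) := by
    refine norm_integral_le_of_norm_le (hint.const_mul _) ?_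
    filter_upwards [ae_restrict_mem measurableSet_Ioi] with t ht
    have ht : 0 < t := ht
    rw [norm_mul, norm_exp_ofReal_mul, Complex.norm_real, Real.norm_eq_abs,
      abs_of_nonneg (landauHeatKernel_nonneg r hh ht)]
    have h1 : Real.exp (z * t) ≤ Real.exp (b * t) := by gcongr
    have h2 : t ≤ 2 / (-b) * Real.exp (-b / 2 * t) := by
      have := Real.add_one_le_exp (-b / 2 * t)
      rw [div_mul_eq_mul_div, le_div_iff₀ (by linarith)]
      linarith
    have h3 : Real.exp (b * t) * Real.exp (-b / 2 * t) = Real.exp (b / 2 * t) := by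
      rw [← Real.exp_add]
      ring_nf
    calc Real.exp (z * t) * landauHeatKernel h r t
        ≤ Real.exp (b * t) * (8 * t / (π * r ^ 4)) :=
          mul_le_mul h1 (landauHeatKernel_le_div hh ht hr)
            (landauHeatKernel_nonneg r hh ht) (Real.exp_pos _).le
      _ ≤ Real.exp (b * t) * (8 * (2 / (-b) * Real.exp (-b / 2 * t)) / (π * r ^ 4)) := by gcongr
      _ = 16 / (π * r ^ 4 * (-b)) * (Real.exp (b * t) * Real.exp (-b / 2 * t)) := by
          have : b ≠ 0 := hb.ne
          field_simp
          norm_num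
      _ = _ := by rw [h3]
  refine key.trans_eq ?_
  rw [integral_const_mul, integral_exp_mul_Ioi (by linarith : b / 2 < 0)]
  have : b ≠ 0 := hb.ne
  simp only [mul_zero, Real.exp_zero]
  field_simp
  norm_num

/-- The correction to the heat kernel on the diagonal is bounded by the field strength. -/
theorem abs_div_sinh_sub_inv_le {h t : ℝ} (hh : 0 < h) (ht : 0 < t) :
    |h / Real.sinh (h * t) - 1 / t| ≤ h := by
  have hx : 0 < h * t := mul_pos hh ht
  have hs : 0 < Real.sinh (h * t) := Real.sinh_pos_iff.2 hx
  have h1 : h * t ≤ Real.sinh (h * t) := Real.self_le_sinh_iff.2 hx.le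
  have h2 := sinh_le_mul_cosh hx.le
  have h3 : Real.cosh (h * t) ≤ 1 + Real.sinh (h * t) := by
    have := Real.cosh_sub_sinh (h * t)
    have : Real.exp (-(h * t)) ≤ 1 := Real.exp_le_one_iff.2 (by linarith)
    linarith
  have h4 : Real.sinh (h * t) ≤ h * t * (1 + Real.sinh (h * t)) :=
    h2.trans (mul_le_mul_of_nonneg_left h3 hx.le)
  rw [div_sub_div _ _ hs.ne' ht.ne', abs_le]
  constructor
  · rw [le_div_iff₀ (by positivity)]
    linarith
  · rw [div_le_iff₀ (by positivity)]
    have : 0 ≤ h * (Real.sinh (h * t) * t) := by positivity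
    linarith

theorem exists_norm_q0_le {a b : ℝ} (hb : b < 0) :
    ∃ D, ∀ z ∈ Icc a b, ‖q0 (z : ℝ)‖ ≤ D := by
  refine isCompact_Icc.exists_bound_of_continuousOn (f := fun z : ℝ => q0 (z : ℂ)) ?_
  unfold q0
  have hlog : ContinuousOn (fun z : ℝ => Complex.log (-(z : ℂ))) (Icc a b) := by
    refine ContinuousOn.clog (by fun_prop) fun z hz => Or.inl ?_
    simpa using hz.2.trans_lt hb
  fun_prop

theorem norm_qDiag_sub_q0_le {b h z : ℝ} (hb : b < 0) (hh : 0 < h) (hz : z ≤ b) :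
    ‖∫ t in Ioi (0 : ℝ),
      Complex.exp (z * t) * (((1 / (4 * π)) * (h / Real.sinh (h * t) - 1 / t) : ℝ) : ℂ)‖ ≤
      h / (-b) := by
  have hint := integrableOn_exp_mul_Ioi hb 0
  have key : ‖∫ t in Ioi (0 : ℝ),
      Complex.exp (z * t) * (((1 / (4 * π)) * (h / Real.sinh (h * t) - 1 / t) : ℝ) : ℂ)‖ ≤
      ∫ t in Ioi (0 : ℝ), h * Real.exp (b * t) := by
    refine norm_integral_le_of_norm_le (hint.const_mul _) ?_
    filter_upwards [ae_restrict_mem measurableSet_Ioi] with t ht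
    have ht : 0 < t := ht
    have hpi : 1 / (4 * π) ≤ 1 := by
      rw [div_le_one (by positivity)]
      linarith [Real.pi_gt_three]
    rw [norm_mul, norm_exp_ofReal_mul, Complex.norm_real, Real.norm_eq_abs, abs_mul,
      abs_of_pos (by positivity : 0 < 1 / (4 * π)), mul_comm h (Real.exp _)]
    refine mul_le_mul (by gcongr) ?_ (by positivity) (Real.exp_pos _).le
    exact (mul_le_of_le_one_left (abs_nonneg _) hpi).trans (abs_div_sinh_sub_inv_le hh ht)
  refine key.trans_eq ?_
  rw [integral_const_mul, integral_exp_mul_Ioi hb]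
  simp only [mul_zero, Real.exp_zero]
  have : b ≠ 0 := hb.ne
  field_simp

theorem summable_inv_one_add_int_sq : Summable fun n : ℤ => 1 / (1 + (n : ℝ) ^ 2) := by
  refine Summable.of_norm_bounded_eventually
    (summable_one_div_int_pow.2 one_lt_two) ?_
  refine (Set.finite_singleton (0 : ℤ)).subset fun n hn => ?_
  by_contra hn0
  refine hn ?_
  have : (n : ℝ) ≠ 0 := by exact_mod_cast hn0
  change ‖1 / (1 + (n : ℝ) ^ 2)‖ ≤ 1 / (n : ℝ) ^ 2
  rw [Real.norm_of_nonneg (by positivity)]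
  gcongr
  linarith

/-- The entries of `Q(z,h)` are dominated by a summable convolution kernel, uniformly in `h`
and `z`. -/
theorem exists_norm_Qmat_le {a b : ℝ} (h₀ : ℝ) (hb : b < 0) :
    ∃ M, ∀ h ∈ Ioc (0 : ℝ) h₀, ∀ z ∈ Icc a b, ∀ m n : ℤ × ℤ,
      ‖Qmat h ((z : ℝ) : ℂ) m n‖ ≤
        M * (1 / (1 + ((m - n).1 : ℝ) ^ 2) * (1 / (1 + ((m - n).2 : ℝ) ^ 2))) := by
  obtain ⟨D, hD⟩ := exists_norm_q0_le (a := a) hb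
  set E := 32 / (π * b ^ 2)
  have hE : 0 ≤ E := by positivity
  refine ⟨max (D + h₀ / (-b)) (9 / 4 * E), fun h hh z hz m n => ?_⟩
  unfold Qmat
  split_ifs with hmn
  · subst hmn
    simp only [sub_self, Prod.fst_zero, Prod.snd_zero, Int.cast_zero, ne_eq, OfNat.ofNat_ne_zero,
      not_false_eq_true, zero_pow, add_zero, div_one, mul_one]
    refine le_max_of_le_left ((norm_add_le _ _).trans (add_le_add (hD z hz) ?_))
    refine (norm_qDiag_sub_q0_le hb hh.1 hz.2).trans ?_
    have : 0 < -b := by linarith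
    gcongr
    exact hh.2
  · have hphase : ‖Complex.exp
        (-Complex.I * h * ((m.1 : ℂ) - n.1) * ((m.2 : ℂ) + n.2) / 2)‖ = 1 := by
      rw [Complex.norm_exp, Real.exp_eq_one_iff]
      have e : -Complex.I * h * ((m.1 : ℂ) - n.1) * ((m.2 : ℂ) + n.2) / 2 =
          ((-(h * ((m.1 : ℝ) - n.1) * ((m.2 : ℝ) + n.2) / 2) : ℝ) : ℂ) * Complex.I := by
        push_cast
        ring
      rw [e, Complex.re_ofReal_mul, Complex.I_re, mul_zero]
    rw [norm_mul, hphase, one_mul]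
    have hx : (((m - n).1 : ℤ) : ℝ) = (m.1 : ℝ) - n.1 := by simp
    have hy : (((m - n).2 : ℤ) : ℝ) = (m.2 : ℝ) - n.2 := by simp
    rw [← hx, ← hy]
    have hk : m - n ≠ 0 := sub_ne_zero.2 hmn
    generalize m - n = k at hk
    have hk1 : 1 ≤ (k.1 : ℝ) ^ 2 + (k.2 : ℝ) ^ 2 := by
      have : 0 < k.1 ^ 2 + k.2 ^ 2 := by
        rcases eq_or_ne k.1 0 with h1 | h1
        · have h2 : k.2 ≠ 0 := fun h2 => hk (Prod.ext h1 h2)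
          positivity
        · positivity
      exact_mod_cast this
    set s := (k.1 : ℝ) ^ 2 + (k.2 : ℝ) ^ 2 with hs
    refine (norm_landauGreen_le hb hh.1 (Real.sqrt_pos.2 (by linarith)) hz.2).trans ?_
    have h4 : Real.sqrt s ^ 4 = s ^ 2 := by
      rw [show (4 : ℕ) = 2 * 2 from rfl, pow_mul, Real.sq_sqrt (by linarith)]
    rw [h4]
    calc E / s ^ 2
        ≤ 9 / 4 * E * (1 / (1 + (k.1 : ℝ) ^ 2) * (1 / (1 + (k.2 : ℝ) ^ 2))) := by
          rw [one_div_mul_one_div, mul_one_div, div_le_div_iff₀ (by positivity) (by positivity)]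
          have hA : (1 + (k.1 : ℝ) ^ 2) * (1 + (k.2 : ℝ) ^ 2) ≤ 9 / 4 * s ^ 2 := by
            nlinarith [sq_nonneg ((k.1 : ℝ) ^ 2 - (k.2 : ℝ) ^ 2), sq_nonneg (k.1 : ℝ),
              sq_nonneg (k.2 : ℝ)]
          nlinarith [mul_le_mul_of_nonneg_left hA hE]
      _ ≤ _ := by
          gcongr
          exact le_max_right _ _

/-- For fixed `a ≤ b < 0` and `h₀>0`, the matrices `Q(z,h)` define bounded operators on
`ℓ²(ℤ²)` with norm bounded by a constant `C` uniformly for `h∈(0,h₀]` and `z∈[a,b]`. -/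
theorem lattice_green_matrix_uniformly_bounded
    (a b h₀ : ℝ) (hab : a ≤ b) (hb : b < 0) (hh₀ : 0 < h₀) :
    ∃ C > 0, ∀ h ∈ Ioc (0 : ℝ) h₀, ∀ z ∈ Icc a b,
      ∃ T : l2Z2 →L[ℂ] l2Z2, ‖T‖ ≤ C ∧
        ∀ (f : l2Z2) (m : ℤ × ℤ), T f m = ∑' n : ℤ × ℤ, Qmat h ((z : ℝ) : ℂ) m n * f n := by
  obtain ⟨M, hM⟩ := exists_norm_Qmat_le (a := a) h₀ hb
  set w : ℤ × ℤ → ℝ := fun k => M * (1 / (1 + (k.1 : ℝ) ^ 2) * (1 / (1 + (k.2 : ℝ) ^ 2)))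
  have hw : Summable w :=
    (summable_inv_one_add_int_sq.mul_of_nonneg summable_inv_one_add_int_sq
      (fun n => by positivity) (fun n => by positivity)).mul_left M
  refine ⟨max 1 (∑' k, w k), by positivity, fun h hh z hz => ?_⟩
  obtain ⟨T, hT, hTf⟩ := exists_clm_of_convolution_bound _ w hw (hM h hh z hz)
  exact ⟨T, hT.trans (le_max_right _ _), hTf⟩
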